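/- arXiv:1909.06198 — 2 statements merged into one kernel-verified Lean document; each statement's English description precedes it below -/
import Mathlib

section
/- Let F be a field, p a monic polynomial of degree n over F and C its companion matrix. The set M = {(X,T) ∈ M_n(F) × M_n(F) : X commutes with C and T - X̃ commutes with C} is an F-vector subspace of M_n(F) × M_n(F) of dimension 2n, where X̃ is the strictly upper triangular matrix whose (i,j) entry equals x_{n,j-i} for i < j and 0 otherwise. -/
open Matrix Polynomial

/-- The companion matrix of a monic polynomial `p` of degree `n`:
ones on the first subdiagonal, `-(coefficients of p)` in the last column. -/
def companionMat (F : Type*) [Field F] (n : ℕ) (p : Polynomial F) :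
    Matrix (Fin n) (Fin n) F :=
  Matrix.of fun i j =>
    if (j : ℕ) = n - 1 then -p.coeff (i : ℕ)
    else if (i : ℕ) = (j : ℕ) + 1 then 1 else 0

/-- For `X ∈ M_n(F)`, the strictly upper triangular matrix `X̃` whose `(i,j)` entry
(1-indexed) is `x_{n, j-i}` for `i < j` and `0` otherwise. -/
def tildeMat {F : Type*} [Field F] {n : ℕ} (X : Matrix (Fin n) (Fin n) F) :
    Matrix (Fin n) (Fin n) F :=
  Matrix.of fun i j =>
    if h : (i : ℕ) < (j : ℕ) then
      X ⟨n - 1, by have := j.isLt; omega⟩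
        ⟨(j : ℕ) - (i : ℕ) - 1, by have := j.isLt; omega⟩
    else 0

def zSub {F : Type*} [Field F] {n : ℕ} (C : Matrix (Fin n) (Fin n) F) :
    Submodule F (Matrix (Fin n) (Fin n) F) where
  carrier := {X | X * C = C * X}
  add_mem' := by
    intro a b ha hb
    simp only [Set.mem_ofPred_eq] at *
    rw [add_mul, mul_add, ha, hb]
  zero_mem' := by simp
  smul_mem' := by
    intro c x hx
    simp only [Set.mem_ofPred_eq] at *
    rw [smul_mul_assoc, mul_smul_comm, hx]

lemma comp_single {F : Type*} [Field F] {m : ℕ} (p : Polynomial F) (k : ℕ) (hk : k < m + 1) :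
    (companionMat F (m+1) p ^ k) *ᵥ Pi.single 0 1 = Pi.single (⟨k, hk⟩ : Fin (m+1)) 1 := by
  induction k with
  | zero => rw [pow_zero, Matrix.one_mulVec]; rfl
  | succ k ih =>
    rw [pow_succ', ← Matrix.mulVec_mulVec, ih (by omega), Matrix.mulVec_single_one]
    ext i
    have h1 : k ≠ m := by omega
    simp [companionMat, Matrix.col_apply, Pi.single_apply, Fin.ext_iff, h1]

lemma zSub_finrank {F : Type*} [Field F] {n : ℕ} (p : Polynomial F) :
    Module.finrank F (zSub (companionMat F n p)) = n := by
  rcases n with _ | m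
  · exact Module.finrank_zero_of_subsingleton
  set C := companionMat F (m+1) p with hC
  let f : zSub C →ₗ[F] (Fin (m+1) → F) :=
    { toFun := fun X => X.1 *ᵥ Pi.single 0 1
      map_add' := fun X Y => Matrix.add_mulVec _ _ _
      map_smul' := fun c X => Matrix.smul_mulVec _ _ _ }
  have hf : Function.Bijective f := by
    constructor
    · rw [injective_iff_map_eq_zero]
      rintro ⟨X, hX⟩ h
      have h0 : X *ᵥ Pi.single 0 1 = 0 := h
      have hc : Commute X C := hX
      ext i j
      have h2 : X *ᵥ Pi.single j 1 = 0 := by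
        rw [← comp_single p j.1 j.2, Matrix.mulVec_mulVec, (hc.pow_right j.1).eq,
          ← Matrix.mulVec_mulVec, h0, Matrix.mulVec_zero]
      rw [Matrix.mulVec_single_one] at h2
      exact congrFun h2 i
    · intro v
      refine ⟨⟨∑ i : Fin (m+1), v i • C ^ (i : ℕ), ?_⟩, ?_⟩
      · change Commute _ C
        exact Commute.sum_left _ _ _ fun i _ => ((Commute.refl C).pow_left _).smul_left _
      · change (∑ i : Fin (m+1), v i • C ^ (i : ℕ)) *ᵥ Pi.single 0 1 = v
        rw [Matrix.sum_mulVec]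
        simp_rw [Matrix.smul_mulVec, hC, comp_single p _ (Fin.is_lt _)]
        ext j
        simp [Finset.sum_apply, Pi.single_apply]
  rw [(LinearEquiv.ofBijective f hf).finrank_eq]
  simp

def tildeLin {F : Type*} [Field F] {n : ℕ} :
    Matrix (Fin n) (Fin n) F →ₗ[F] Matrix (Fin n) (Fin n) F where
  toFun := tildeMat
  map_add' X Y := by
    ext i j
    by_cases h : i < j <;> simp [tildeMat, h]
  map_smul' c X := by
    ext i j
    by_cases h : i < j <;> simp [tildeMat, h]

/-- the set of pairs `(X,T)` with `X` commuting with the companion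
matrix `C` and `T - X̃` commuting with `C` is an `F`-vector subspace of
`M_n(F) × M_n(F)` of dimension `2n`. -/
theorem pairs_subspace_dim
    {F : Type*} [Field F] {n : ℕ}
    (p : Polynomial F) (hmonic : p.Monic) (hdeg : p.natDegree = n) :
    ∃ S : Submodule F (Matrix (Fin n) (Fin n) F × Matrix (Fin n) (Fin n) F),
      (↑S = {XT : Matrix (Fin n) (Fin n) F × Matrix (Fin n) (Fin n) F |
          XT.1 * companionMat F n p = companionMat F n p * XT.1 ∧
          (XT.2 - tildeMat XT.1) * companionMat F n p =
            companionMat F n p * (XT.2 - tildeMat XT.1)}) ∧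
      Module.finrank F S = 2 * n := by
  let L : (zSub (companionMat F n p) × zSub (companionMat F n p)) →ₗ[F]
      (Matrix (Fin n) (Fin n) F × Matrix (Fin n) (Fin n) F) :=
    LinearMap.prod ((zSub _).subtype ∘ₗ LinearMap.fst F _ _)
      ((zSub _).subtype ∘ₗ LinearMap.snd F _ _ +
        tildeLin ∘ₗ (zSub _).subtype ∘ₗ LinearMap.fst F _ _)
  have hL : ∀ a, L a = (a.1.1, a.2.1 + tildeMat a.1.1) := fun a => rfl
  refine ⟨LinearMap.range L, ?_, ?_⟩
  · ext ⟨X, T⟩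
    simp only [SetLike.mem_coe, LinearMap.mem_range, Set.mem_ofPred_eq, hL]
    constructor
    · rintro ⟨⟨⟨A, hA⟩, ⟨B, hB⟩⟩, h⟩
      simp only [Prod.mk.injEq] at h
      obtain ⟨rfl, rfl⟩ := h
      rw [add_sub_cancel_right]
      exact ⟨hA, hB⟩
    · rintro ⟨h1, h2⟩
      exact ⟨⟨⟨X, h1⟩, ⟨T - tildeMat X, h2⟩⟩, by simp⟩
  · rw [LinearMap.finrank_range_of_inj, Module.finrank_prod, zSub_finrank, two_mul]
    rintro ⟨⟨A, hA⟩, ⟨B, hB⟩⟩ ⟨⟨A', hA'⟩, ⟨B', hB'⟩⟩ h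
    simp only [hL, Prod.mk.injEq] at h
    obtain ⟨rfl, h⟩ := h
    have := add_right_cancel h
    subst this
    rfl
end

section
/- Let F be a field, p a monic irreducible and separable polynomial of degree s over F with companion matrix C, and let G ∈ M_{sℓ}(F) be the generalized Jordan block of the first kind of size ℓ associated with p. An sℓ × sℓ matrix X over F commutes with G if and only if there exist s×s matrices X_1, X_2, …, X_ℓ over F, each commuting with C, such that X is the block lower triangular block-Toeplitz matrix whose (i,j) s×s block equals X_{i-j+1} when i ≥ j and 0 when i < j. -/
open Matrix Polynomial

/-- The generalized Jordan block of the first kind of size `ℓ` associated with `p`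
(degree `s`): the `sℓ × sℓ` block matrix with `ℓ` diagonal `s×s` blocks equal to the
companion matrix `C` of `p`, identity `s×s` blocks directly below the diagonal, and
zeros elsewhere. Rows/columns indexed by `Fin ℓ × Fin s`. -/
def genJordanBlockOne (F : Type*) [Field F] (s ℓ : ℕ) (p : Polynomial F) :
    Matrix (Fin ℓ × Fin s) (Fin ℓ × Fin s) F :=
  Matrix.of fun x y =>
    if x.1 = y.1 then companionMat F s p x.2 y.2
    else if (x.1 : ℕ) = (y.1 : ℕ) + 1 then (1 : Matrix (Fin s) (Fin s) F) x.2 y.2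
    else 0

theorem aux_aeval_companion {F : Type*} [Field F] {s : ℕ} (p : Polynomial F)
    (hmonic : p.Monic) (hs : 0 < s) (hdeg : p.natDegree = s) :
    aeval (companionMat F s p) p = 0 := by
  set C := companionMat F s p with hC
  have hpow : ∀ k (hk : k < s), C ^ k *ᵥ Pi.single ⟨0, hs⟩ 1 = Pi.single (⟨k, hk⟩ : Fin s) 1 := by
    intro k
    induction k with
    | zero => intro hk; rw [pow_zero, one_mulVec]
    | succ k ih =>
      intro hk
      rw [pow_succ', ← mulVec_mulVec, ih (by omega), mulVec_single_one]
      ext i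
      have h1 : k ≠ s - 1 := by omega
      simp [hC, companionMat, h1, Pi.single_apply, Fin.ext_iff]
  have hlast : C ^ s *ᵥ Pi.single ⟨0, hs⟩ 1 = fun i : Fin s => -p.coeff i := by
    obtain ⟨t, rfl⟩ : ∃ t, s = t + 1 := ⟨s - 1, by omega⟩
    rw [pow_succ', ← mulVec_mulVec, hpow t (by omega), mulVec_single_one]
    ext i
    simp [hC, companionMat]
  have h0 : aeval C p *ᵥ Pi.single ⟨0, hs⟩ 1 = 0 := by
    rw [aeval_eq_sum_range, hdeg, Finset.sum_range_succ, Matrix.add_mulVec]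
    have hc : p.coeff s = 1 := by rw [← hdeg]; exact hmonic
    rw [hc, one_smul, hlast, Finset.sum_range, Matrix.sum_mulVec]
    ext m
    simp only [Matrix.smul_mulVec, hpow, Fin.is_lt, Pi.add_apply, Finset.sum_apply, Pi.smul_apply, Pi.single_apply, smul_eq_mul]
    simp
  have hk : ∀ k : Fin s, aeval C p *ᵥ Pi.single k 1 = 0 := by
    intro k
    rw [← hpow k k.2, mulVec_mulVec]
    have : Commute (aeval C p) (C ^ (k : ℕ)) := by
      have := Polynomial.aeval_X_pow (R := F) (x := C) (n := (k : ℕ))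
      rw [← this]
      exact (Commute.all p (X ^ (k : ℕ))).map (aeval C)
    rw [this.eq, ← mulVec_mulVec, h0, mulVec_zero]
  ext i j
  have := congrFun (hk j) i
  rw [mulVec_single_one] at this
  simpa using this

theorem aux_comm {F A : Type*} [Field F] [Ring A] [Algebra F A] (D Y : A)
    (h : Commute D (Y * D - D * Y)) (q : Polynomial F) :
    Y * aeval D q - aeval D q * Y = aeval D (derivative q) * (Y * D - D * Y) := by
  set Z := Y * D - D * Y with hZ
  have hY : Y * D = D * Y + Z := by rw [hZ]; abel
  induction q using Polynomial.induction_on' with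
  | add a b ha hb =>
    simp only [map_add, mul_add, add_mul, ← ha, ← hb]; abel
  | monomial n a =>
    have key : ∀ n : ℕ, Y * D ^ n - D ^ n * Y = (n : A) * D ^ (n - 1) * Z := by
      intro n
      induction n with
      | zero => simp
      | succ n ih =>
        have e : Y * D ^ n = D ^ n * Y + (n : A) * D ^ (n - 1) * Z := by rw [← ih]; abel
        rw [pow_succ, ← mul_assoc, e, add_mul, mul_assoc _ Y D, hY, mul_assoc _ Z D, ← h.eq]
        rcases n with _ | n
        · simp
        · simp only [Nat.add_sub_cancel, pow_succ, Nat.cast_add, Nat.cast_one, mul_add, add_mul, mul_assoc, one_mul]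
          abel
    simp only [derivative_monomial, aeval_monomial]
    rw [← mul_assoc, ← Algebra.commutes, mul_assoc, mul_assoc, ← mul_sub, key]
    simp [mul_assoc]

theorem aux_ker {F A : Type*} [Field F] [Ring A] [Algebra F A] (D Y : A)
    (p : Polynomial F) (hsep : p.Separable) (hp : aeval D p = 0)
    (h : Commute D (Y * D - D * Y)) : Y * D - D * Y = 0 := by
  have h1 := aux_comm (F := F) D Y h p
  rw [hp, mul_zero, zero_mul, sub_zero] at h1
  obtain ⟨a, b, hab⟩ := hsep
  have h2 := congrArg (aeval D) hab
  simp only [map_add, map_mul, hp, mul_zero, zero_add, map_one] at h2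
  rw [← one_mul (Y * D - D * Y), ← h2, mul_assoc, ← h1, mul_zero]

def auxAd (F : Type*) {A : Type*} [Field F] [Ring A] [Algebra F A] (a : A) : Module.End F A :=
  LinearMap.mulLeft F a - LinearMap.mulRight F a

theorem auxAd_apply (F : Type*) {A : Type*} [Field F] [Ring A] [Algebra F A] (a x : A) :
    auxAd F a x = a * x - x * a := by simp [auxAd]

theorem auxAd_nil (F : Type*) {A : Type*} [Field F] [Ring A] [Algebra F A] {a : A}
    (h : IsNilpotent a) : IsNilpotent (auxAd F a) := by
  have hl : IsNilpotent (LinearMap.mulLeft F a) := by rwa [LinearMap.isNilpotent_mulLeft_iff]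
  have hr : IsNilpotent (LinearMap.mulRight F a) := by rwa [LinearMap.isNilpotent_mulRight_iff]
  exact (LinearMap.commute_mulLeft_right a a).isNilpotent_sub hl hr

theorem aux_jc {F A : Type*} [Field F] [Ring A] [Algebra F A] (D N Y : A)
    (p : Polynomial F) (hsep : p.Separable) (hp : aeval D p = 0)
    (hDN : Commute D N) (hN : IsNilpotent N) (h : Commute Y (D + N)) :
    Commute Y D ∧ Commute Y N := by
  have hk : ∀ k (Z : A), ((auxAd F D) ^ k) Z = 0 → Commute Z (D + N) → Commute Z D := by
    intro k
    induction k with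
    | zero => intro Z hZ _; simp at hZ; subst hZ; exact Commute.zero_left D
    | succ k ih =>
      intro Z hZ hc
      rw [pow_succ, Module.End.mul_apply] at hZ
      have hc2 : Commute (auxAd F D Z) (D + N) := by
        have : Commute D (D + N) := (Commute.refl D).add_right hDN
        rw [auxAd_apply]
        exact (this.mul_left hc).sub_left (hc.mul_left this)
      have h3 := ih _ hZ hc2
      have h4 : Commute D (Z * D - D * Z) := by
        have := h3.symm.neg_right
        rwa [auxAd_apply, neg_sub] at this
      exact sub_eq_zero.1 (aux_ker D Z p hsep hp h4)
  have hDN' : ∀ k, ((auxAd F D) ^ k) Y = (-1) ^ k • ((auxAd F N) ^ k) Y := by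
    have hcomm : Commute (auxAd F D) (auxAd F N) := by
      refine LinearMap.ext fun x => ?_
      simp only [Module.End.mul_apply, auxAd_apply, mul_sub, sub_mul, ← mul_assoc]
      rw [hDN.eq, mul_assoc x N D, ← hDN.eq, ← mul_assoc]
      abel
    have h1 : auxAd F D Y = - auxAd F N Y := by
      have := h.eq
      simp only [auxAd_apply]
      rw [mul_add, add_mul] at this
      rw [neg_sub, sub_eq_sub_iff_add_eq_add, ← this]
      abel
    intro k
    induction k with
    | zero => simp
    | succ k ih =>
      rw [pow_succ', Module.End.mul_apply, ih, map_zsmul, ← Module.End.mul_apply,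
        (hcomm.pow_right k).eq, Module.End.mul_apply, h1, pow_succ (auxAd F N),
        Module.End.mul_apply, map_neg, pow_succ]
      simp
  obtain ⟨n, hn⟩ := auxAd_nil F hN
  have hD := hk n Y (by rw [hDN' n, hn]; simp) h
  refine ⟨hD, ?_⟩
  have := h.sub_right hD
  simpa using this

def auxN (ℓ : ℕ) (R : Type*) [Ring R] : Matrix (Fin ℓ) (Fin ℓ) R :=
  Matrix.of fun i j => if (i : ℕ) = (j : ℕ) + 1 then 1 else 0

theorem auxN_mul {ℓ : ℕ} {R : Type*} [Ring R] (Y : Matrix (Fin ℓ) (Fin ℓ) R) (i j : Fin ℓ) :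
    (auxN ℓ R * Y) i j = if h : 0 < (i : ℕ) then Y ⟨i - 1, by omega⟩ j else 0 := by
  rw [Matrix.mul_apply]
  split_ifs with h
  · rw [Finset.sum_eq_single ⟨i - 1, by omega⟩]
    · have : (i : ℕ) = i - 1 + 1 := by omega
      simp [auxN, ← this]
    · intro b _ hb
      have : (i : ℕ) ≠ b + 1 := fun e => hb (Fin.ext (by simp; omega))
      simp [auxN, this]
    · simp
  · apply Finset.sum_eq_zero
    intro b _
    have : (i : ℕ) ≠ b + 1 := by omega
    simp [auxN, this]

theorem mul_auxN {ℓ : ℕ} {R : Type*} [Ring R] (Y : Matrix (Fin ℓ) (Fin ℓ) R) (i j : Fin ℓ) :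
    (Y * auxN ℓ R) i j = if h : (j : ℕ) + 1 < ℓ then Y i ⟨j + 1, h⟩ else 0 := by
  rw [Matrix.mul_apply]
  split_ifs with h
  · rw [Finset.sum_eq_single ⟨j + 1, h⟩]
    · simp [auxN]
    · intro b _ hb
      have : (b : ℕ) ≠ j + 1 := fun e => hb (Fin.ext (by simp; omega))
      simp [auxN, this]
    · simp
  · apply Finset.sum_eq_zero
    intro b _
    have : (b : ℕ) ≠ j + 1 := by omega
    simp [auxN, this]

theorem auxN_pow {ℓ : ℕ} {R : Type*} [Ring R] (k : ℕ) (i j : Fin ℓ) (h : (i : ℕ) < j + k) :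
    (auxN ℓ R ^ k) i j = 0 := by
  induction k generalizing i j with
  | zero =>
    have : i ≠ j := fun e => by subst e; omega
    simp [this]
  | succ k ih =>
    rw [pow_succ', auxN_mul]
    split_ifs with h0
    · exact ih _ _ (by simp; omega)
    · rfl

theorem auxN_nil {ℓ : ℕ} {R : Type*} [Ring R] : IsNilpotent (auxN ℓ R) :=
  ⟨ℓ, by ext i j; exact auxN_pow ℓ i j (by omega)⟩

theorem aux_toeplitz {ℓ : ℕ} {R : Type*} [Ring R] (Y : Matrix (Fin ℓ) (Fin ℓ) R) :
    Commute Y (auxN ℓ R) ↔ ∀ i j : Fin ℓ, Y i j =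
      if h : (j : ℕ) ≤ (i : ℕ) then
        Y ⟨(i : ℕ) - (j : ℕ), by omega⟩ ⟨0, by omega⟩ else 0 := by
  constructor
  · intro h i j
    obtain ⟨j, hj⟩ := j
    induction j generalizing i with
    | zero => simp
    | succ j ih =>
      have := congrFun (congrFun h.eq i) ⟨j, by omega⟩
      rw [auxN_mul, mul_auxN, dif_pos hj] at this
      rw [this]
      by_cases h0 : 0 < (i : ℕ)
      · rw [dif_pos h0, ih]
        by_cases h1 : j + 1 ≤ (i : ℕ)
        · have h2 : j ≤ (i : ℕ) - 1 := by omega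
          have h3 : (i : ℕ) - 1 - j = i - (j + 1) := by omega
          simp only [h1, h2, h3, dif_pos]
        · have h2 : ¬ j ≤ (i : ℕ) - 1 := by omega
          simp only [h1, h2, dif_neg, not_false_eq_true]
      · have h2 : ¬ j + 1 ≤ (i : ℕ) := by omega
        simp only [h0, h2, dif_neg, not_false_eq_true]
  · intro h
    ext1 i j
    rw [auxN_mul, mul_auxN]
    by_cases h0 : 0 < (i : ℕ) <;> by_cases h1 : (j : ℕ) + 1 < ℓ
    · rw [dif_pos h0, dif_pos h1, h i, h _ j]
      by_cases h2 : (j : ℕ) + 1 ≤ i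
      · have h3 : (j : ℕ) ≤ i - 1 := by omega
        have h4 : (i : ℕ) - 1 - j = i - (j + 1) := by omega
        simp only [h2, h3, h4, dif_pos]
      · have h3 : ¬ (j : ℕ) ≤ i - 1 := by omega
        simp only [h2, h3, dif_neg, not_false_eq_true]
    · rw [dif_pos h0, dif_neg h1, h _ j, dif_neg]
      simp; omega
    · rw [dif_neg h0, dif_pos h1, h i, dif_neg]
      simp; omega
    · rw [dif_neg h0, dif_neg h1]

theorem aux_scalar {ℓ : ℕ} {R : Type*} [Ring R] (C : R) (Y : Matrix (Fin ℓ) (Fin ℓ) R) :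
    Commute Y (Matrix.scalar (Fin ℓ) C) ↔ ∀ i j, Y i j * C = C * Y i j := by
  rw [commute_iff_eq, ← Matrix.ext_iff]
  simp [Matrix.scalar_apply]

theorem aux_block {F : Type*} [Field F] {s ℓ : ℕ} (p : Polynomial F) (hs : 0 < s)
    (hmonic : p.Monic) (hsep : p.Separable) (hdeg : p.natDegree = s)
    (Y : Matrix (Fin ℓ) (Fin ℓ) (Matrix (Fin s) (Fin s) F)) :
    Commute Y (Matrix.scalar (Fin ℓ) (companionMat F s p) + auxN ℓ _) ↔
      (∀ i j, Y i j * companionMat F s p = companionMat F s p * Y i j) ∧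
      ∀ i j : Fin ℓ, Y i j =
      if h : (j : ℕ) ≤ (i : ℕ) then
        Y ⟨(i : ℕ) - (j : ℕ), by omega⟩ ⟨0, by omega⟩ else 0 := by
  rw [← aux_toeplitz, ← aux_scalar]
  constructor
  · intro h
    refine aux_jc (F := F) _ _ Y p hsep ?_ ?_ auxN_nil h
    · rw [← Matrix.scalarAlgHom_apply (n := Fin ℓ) (R := F), Polynomial.aeval_algHom_apply,
        aux_aeval_companion p hmonic hs hdeg, map_zero]
    · refine ((aux_scalar _ _).2 fun i j => ?_).symm
      by_cases h : (i : ℕ) = j + 1 <;> simp [auxN, h]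
  · rintro ⟨h1, h2⟩
    exact h1.add_right h2

/-- for `p` monic irreducible separable of degree `s`, a matrix `X`
commutes with the generalized Jordan block of the first kind `G` of size `ℓ` iff
`X` is block lower triangular block-Toeplitz with blocks `X_1, …, X_ℓ`, each
commuting with the companion matrix `C`. -/
theorem centralizer_genJordanBlockOne
    {F : Type*} [Field F] {s ℓ : ℕ}
    (p : Polynomial F) (hmonic : p.Monic) (hirr : Irreducible p)
    (hsep : p.Separable) (hdeg : p.natDegree = s)
    (X : Matrix (Fin ℓ × Fin s) (Fin ℓ × Fin s) F) :
    X * genJordanBlockOne F s ℓ p = genJordanBlockOne F s ℓ p * X ↔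
      ∃ B : Fin ℓ → Matrix (Fin s) (Fin s) F,
        (∀ i : Fin ℓ, B i * companionMat F s p = companionMat F s p * B i) ∧
        (∀ x y : Fin ℓ × Fin s,
          X x y =
            if h : (y.1 : ℕ) ≤ (x.1 : ℕ) then
              B ⟨(x.1 : ℕ) - (y.1 : ℕ), by have := x.1.isLt; omega⟩ x.2 y.2
            else 0) := by
  have hs : 0 < s := by rw [← hdeg]; exact hirr.natDegree_pos
  set Y := (Matrix.compRingEquiv (Fin ℓ) (Fin s) F).symm X with hY
  have hYX : ∀ x y : Fin ℓ × Fin s, X x y = Y x.1 y.1 x.2 y.2 := fun x y => rfl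
  have hG : genJordanBlockOne F s ℓ p = Matrix.compRingEquiv (Fin ℓ) (Fin s) F
      (Matrix.scalar (Fin ℓ) (companionMat F s p) + auxN ℓ _) := by
    ext ⟨i, a⟩ ⟨j, b⟩
    simp only [compRingEquiv_apply, Matrix.comp_apply, Matrix.add_apply]
    by_cases h : i = j
    · subst h
      simp [genJordanBlockOne, auxN]
    · by_cases h' : (i : ℕ) = j + 1 <;>
      simp [genJordanBlockOne, auxN, h, h']
  have hX : X = Matrix.compRingEquiv (Fin ℓ) (Fin s) F Y := by simp [hY]
  have h1 : X * genJordanBlockOne F s ℓ p = genJordanBlockOne F s ℓ p * X ↔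
      Commute Y (Matrix.scalar (Fin ℓ) (companionMat F s p) + auxN ℓ _) := by
    rw [hG, hX, ← map_mul, ← map_mul, (RingEquiv.injective _).eq_iff, commute_iff_eq]
  rw [h1, aux_block p hs hmonic hsep hdeg]
  constructor
  · rintro ⟨h2, h3⟩
    refine ⟨fun i => Y i ⟨0, i.pos⟩, fun i => h2 _ _, fun x y => ?_⟩
    rw [hYX, h3]
    split_ifs <;> rfl
  · rintro ⟨B, hB, hXB⟩
    have h3 : ∀ i j : Fin ℓ, Y i j = if h : (j : ℕ) ≤ (i : ℕ) then
        B ⟨(i : ℕ) - (j : ℕ), by omega⟩ else 0 := by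
      intro i j
      ext a b
      have := hXB (i, a) (j, b)
      rw [hYX] at this
      simp only at this
      rw [this]
      split_ifs <;> rfl
    constructor
    · intro i j
      rw [h3]
      split_ifs
      · exact hB _
      · simp
    · intro i j
      rw [h3 i j]
      split_ifs
      · rw [h3]; simp
      · rfl
end
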